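/- For all a, b ≥ 1, α ∈ ℕ^a, β ∈ ℕ^b, and n ∈ ℕ, the cardinality of Q(α,β,n,1) equals Σ_{γ ∈ L(α,β,n)} f_γ, where f_γ = #{(i,j) ∈ {1,…,a} × {1,…,b} : γ_{ij} ≠ 0}. -/

import Mathlib

open Finset

/-- Total size `|Γ| = Σ_{i,j,k} Γ_{ij}^k` of a cubical matrix. -/
def qTotal {a b : ℕ} (Γ : Fin (a+1) → Fin (b+1) → ℕ →₀ ℕ) : ℕ :=
  ∑ i, ∑ j, (Γ i j).sum fun _ v => v

/-- Weight `Σ_{i,j,k} k·Γ_{ij}^k` of a cubical matrix. -/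
def qWeight {a b : ℕ} (Γ : Fin (a+1) → Fin (b+1) → ℕ →₀ ℕ) : ℕ :=
  ∑ i, ∑ j, (Γ i j).sum fun k v => k * v

/-- The smash `Γ̄_{ij} = Σ_k Γ_{ij}^k` of a cubical matrix. -/
def smash {a b : ℕ} (Γ : Fin (a+1) → Fin (b+1) → ℕ →₀ ℕ) :
    Fin (a+1) → Fin (b+1) → ℕ :=
  fun i j => (Γ i j).sum fun _ v => v

/-- Membership in `Q(α,β,n,m)`: cubical matrices (with finitely many nonzero
entries, encoded via finsupp in the level index `k`) satisfying the marginal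
and weight conditions. -/
def IsCubical {a b : ℕ} (α : Fin a → ℕ) (β : Fin b → ℕ) (n m : ℕ)
    (Γ : Fin (a+1) → Fin (b+1) → ℕ →₀ ℕ) : Prop :=
  (∀ k : ℕ, Γ 0 0 k = 0) ∧
  (∀ (i : Fin (a+1)) (j : Fin (b+1)) (k : ℕ), 1 ≤ k → (i = 0 ∨ j = 0) → Γ i j k = 0) ∧
  qTotal Γ ≤ n ∧
  qWeight Γ = m ∧
  (∀ i : Fin a, ∑ j, (Γ i.succ j).sum (fun _ v => v) = α i) ∧
  (∀ j : Fin b, ∑ i, (Γ i j.succ).sum (fun _ v => v) = β j)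

/-- Membership in the support `Q^s(α,β,n,m)` at level `s`. -/
def InSupport {a b : ℕ} (α : Fin a → ℕ) (β : Fin b → ℕ) (n m s : ℕ)
    (Γ : Fin (a+1) → Fin (b+1) → ℕ →₀ ℕ) : Prop :=
  IsCubical α β n m Γ ∧
  (∀ (i : Fin (a+1)) (j : Fin (b+1)) (k : ℕ), s < k → Γ i j k = 0) ∧
  (∃ (i : Fin (a+1)) (j : Fin (b+1)), Γ i j s ≠ 0)

/-- Membership in `L(α,β,n)`. -/
def IsL {a b : ℕ} (α : Fin a → ℕ) (β : Fin b → ℕ) (n : ℕ)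
    (γ : Fin (a+1) → Fin (b+1) → ℕ) : Prop :=
  γ 0 0 = 0 ∧
  (∑ i, ∑ j, γ i j) ≤ n ∧
  (∀ i : Fin a, ∑ j, γ i.succ j = α i) ∧
  (∀ j : Fin b, ∑ i, γ i j.succ = β j)

/-- `ψ(Γ) = w` : the 3-word `w` (a `3 × N` matrix, given as the list of its `N`
columns) is obtained by concatenating, in lexicographic order of the triples
`(k,i,j)`, exactly `Γ_{ij}^k` copies of the column `(k, i+1, j+1)`. -/
def IsPsi {a b : ℕ} (Γ : Fin (a+1) → Fin (b+1) → ℕ →₀ ℕ) {N : ℕ}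
    (w : Fin N → ℕ × ℕ × ℕ) : Prop :=
  (∀ t u : Fin N, t ≤ u →
    ((w t).1 < (w u).1 ∨ ((w t).1 = (w u).1 ∧
      ((w t).2.1 < (w u).2.1 ∨ ((w t).2.1 = (w u).2.1 ∧ (w t).2.2 ≤ (w u).2.2))))) ∧
  (∀ (k : ℕ) (i : Fin (a+1)) (j : Fin (b+1)),
    (Finset.univ.filter (fun t => w t = (k, (i : ℕ) + 1, (j : ℕ) + 1))).card = Γ i j k) ∧
  (∀ t : Fin N, ∃ (k : ℕ) (i : Fin (a+1)) (j : Fin (b+1)),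
    w t = (k, (i : ℕ) + 1, (j : ℕ) + 1))

/-- A 3-word: first row weakly increasing, second and third rows positive,
equal consecutive first-row entries force increasing second row, and equal
consecutive second-row entries force increasing third row. -/
def IsThreeWord {N : ℕ} (w : Fin N → ℕ × ℕ × ℕ) : Prop :=
  (∀ t u : Fin N, t ≤ u → (w t).1 ≤ (w u).1) ∧
  (∀ t : Fin N, 1 ≤ (w t).2.1 ∧ 1 ≤ (w t).2.2) ∧
  (∀ (t : ℕ) (ht : t + 1 < N),
    ((w ⟨t, Nat.lt_of_succ_lt ht⟩).1 = (w ⟨t+1, ht⟩).1 →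
      (w ⟨t, Nat.lt_of_succ_lt ht⟩).2.1 ≤ (w ⟨t+1, ht⟩).2.1) ∧
    ((w ⟨t, Nat.lt_of_succ_lt ht⟩).2.1 = (w ⟨t+1, ht⟩).2.1 →
      (w ⟨t, Nat.lt_of_succ_lt ht⟩).2.2 ≤ (w ⟨t+1, ht⟩).2.2))

/-- Membership in `A(α,β,n,m)` for a 3-word with `N` columns. -/
def InA {a b : ℕ} (α : Fin a → ℕ) (β : Fin b → ℕ) (n m : ℕ) {N : ℕ}
    (w : Fin N → ℕ × ℕ × ℕ) : Prop :=
  IsThreeWord w ∧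
  N ≤ n ∧
  (∀ t : Fin N, (w t).2.1 = (w t).2.2 → (w t).2.1 ≠ 1) ∧
  (∀ t : Fin N, 0 < (w t).1 → 1 < (w t).2.1 ∧ 1 < (w t).2.2) ∧
  (∑ t, (w t).1 = m) ∧
  (∀ t : Fin N, (w t).2.1 ≤ a + 1 ∧ (w t).2.2 ≤ b + 1) ∧
  (∀ v : Fin a, (Finset.univ.filter (fun t => (w t).2.1 = (v : ℕ) + 2)).card = α v) ∧
  ((Finset.univ.filter (fun t : Fin N => (w t).2.1 = 1)).card = N - ∑ v, α v) ∧
  (∀ v : Fin b, (Finset.univ.filter (fun t => (w t).2.2 = (v : ℕ) + 2)).card = β v) ∧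
  ((Finset.univ.filter (fun t : Fin N => (w t).2.2 = 1)).card = N - ∑ v, β v)

theorem exists_eq_one_of_sum_eq_one {ι : Type*} [Fintype ι] [DecidableEq ι] {w : ι → ℕ}
    (h : ∑ i, w i = 1) : ∃ p, w p = 1 ∧ ∀ i, i ≠ p → w i = 0 := by
  obtain ⟨p, -, hp⟩ := Finset.exists_ne_zero_of_sum_ne_zero (by omega : ∑ i, w i ≠ 0)
  rw [← Finset.add_sum_erase _ _ (Finset.mem_univ p)] at h
  have hz : ∑ i ∈ Finset.univ.erase p, w i = 0 := by omega
  rw [Finset.sum_eq_zero_iff] at hz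
  exact ⟨p, by omega, fun i hi => hz i (by simp [hi])⟩

theorem eq_single_of_weight_eq_zero {f : ℕ →₀ ℕ} (h : (f.sum fun k v => k * v) = 0) :
    f = Finsupp.single 0 (f.sum fun _ v => v) := by
  have h' : ∀ k, k ≠ 0 → f k = 0 := by
    intro k hk
    by_contra hf
    have := Finset.sum_eq_zero_iff.mp h k (by simpa using hf)
    simp [hk, hf] at this
  have e : f = Finsupp.single 0 (f 0) := by
    ext k
    by_cases hk : k = 0
    · simp [hk]
    · simp [h' k hk, Ne.symm hk]
  rw [e]
  simp

theorem sum_single_zero_add_single_one {g : ℕ → ℕ → ℕ} (h0 : ∀ k, g k 0 = 0)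
    (h1 : ∀ k v w, g k (v + w) = g k v + g k w) (t : ℕ) :
    (Finsupp.single 0 t + Finsupp.single 1 1 : ℕ →₀ ℕ).sum g = g 0 t + g 1 1 := by
  rw [Finsupp.sum_add_index' h0 h1, Finsupp.sum_single_index (h0 _),
    Finsupp.sum_single_index (h0 _)]

theorem eq_single_add_single_of_weight_eq_one {f : ℕ →₀ ℕ} (h : (f.sum fun k v => k * v) = 1) :
    f = Finsupp.single 0 ((f.sum fun _ v => v) - 1) + Finsupp.single 1 1 := by
  obtain ⟨p, hp, hne⟩ : ∃ p ∈ f.support, p * f p ≠ 0 :=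
    Finset.exists_ne_zero_of_sum_ne_zero (by rw [Finsupp.sum] at h; omega)
  rw [Finsupp.sum, ← Finset.add_sum_erase _ _ hp] at h
  have hz : ∑ k ∈ f.support.erase p, k * f k = 0 := by omega
  rw [Finset.sum_eq_zero_iff] at hz
  obtain ⟨rfl, hf⟩ : p = 1 ∧ f p = 1 := by rw [← mul_eq_one]; omega
  have e : f = Finsupp.single 0 (f 0) + Finsupp.single 1 1 := by
    ext k
    by_cases hk : k = 0
    · simp [hk]
    by_cases hk1 : k = 1
    · simp [hk1, hf]
    have : f k = 0 := by
      by_contra hfk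
      have := hz k (by simp [hk1, hfk])
      simp [hk, hfk] at this
    simp [this, Ne.symm hk, Ne.symm hk1]
  rw [e, sum_single_zero_add_single_one (fun _ => rfl) (fun _ _ _ => rfl)]
  simp

/-- The cubical matrix obtained from `γ` by raising one unit of the entry at `x` to level `1`. -/
noncomputable def raise {a b : ℕ} (γ : Fin (a+1) → Fin (b+1) → ℕ) (x : Fin a × Fin b) :
    Fin (a+1) → Fin (b+1) → ℕ →₀ ℕ :=
  fun i j => if i = x.1.succ ∧ j = x.2.succ then
    Finsupp.single 0 (γ i j - 1) + Finsupp.single 1 1 else Finsupp.single 0 (γ i j)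

theorem smash_raise {a b : ℕ} {γ : Fin (a+1) → Fin (b+1) → ℕ} {x : Fin a × Fin b}
    (hx : γ x.1.succ x.2.succ ≠ 0) : smash (raise γ x) = γ := by
  funext i j
  unfold smash raise
  split_ifs with h
  · obtain ⟨rfl, rfl⟩ := h
    rw [sum_single_zero_add_single_one (fun _ => rfl) (fun _ _ _ => rfl)]
    omega
  · simp

theorem raise_apply_one {a b : ℕ} (γ : Fin (a+1) → Fin (b+1) → ℕ) (x : Fin a × Fin b)
    (i : Fin (a+1)) (j : Fin (b+1)) :
    raise γ x i j 1 = if i = x.1.succ ∧ j = x.2.succ then 1 else 0 := by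
  unfold raise
  split_ifs <;> simp

theorem raise_injective_right {a b : ℕ} (γ : Fin (a+1) → Fin (b+1) → ℕ) :
    Function.Injective (raise γ) := by
  intro x y h
  have := raise_apply_one γ x x.1.succ x.2.succ
  rw [h, raise_apply_one] at this
  simpa [Prod.ext_iff] using this

theorem qWeight_raise {a b : ℕ} (γ : Fin (a+1) → Fin (b+1) → ℕ) (x : Fin a × Fin b) :
    qWeight (raise γ x) = 1 := by
  have h : ∀ i j, ((raise γ x i j).sum fun k v => k * v) =
      if i = x.1.succ then (if j = x.2.succ then 1 else 0) else 0 := by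
    intro i j
    rw [← ite_and]
    unfold raise
    split_ifs with h
    · rw [sum_single_zero_add_single_one (fun _ => rfl) (fun _ _ _ => mul_add _ _ _)]
      simp
    · simp
  unfold qWeight
  simp [h]

theorem IsL.isCubical_raise {a b n : ℕ} {α : Fin a → ℕ} {β : Fin b → ℕ}
    {γ : Fin (a+1) → Fin (b+1) → ℕ} (hγ : IsL α β n γ) {x : Fin a × Fin b}
    (hx : γ x.1.succ x.2.succ ≠ 0) : IsCubical α β n 1 (raise γ x) := by
  have hs := smash_raise hx
  have hz : ∀ i j, (i = 0 ∨ j = 0) → raise γ x i j = Finsupp.single 0 (γ i j) := by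
    rintro i j (rfl | rfl) <;> simp [raise, (Fin.succ_ne_zero _).symm]
  rw [← hs] at hγ
  refine ⟨fun k => ?_, fun i j k hk h => ?_, hγ.2.1, qWeight_raise γ x, hγ.2.2.1, hγ.2.2.2⟩
  · have h0 : γ 0 0 = 0 := by simpa [hs] using hγ.1
    simp [hz 0 0 (.inl rfl), h0]
  · rw [hz i j h, Finsupp.single_eq_of_ne (by omega)]

theorem IsCubical.isL_smash {a b n m : ℕ} {α : Fin a → ℕ} {β : Fin b → ℕ}
    {Γ : Fin (a+1) → Fin (b+1) → ℕ →₀ ℕ} (h : IsCubical α β n m Γ) : IsL α β n (smash Γ) := by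
  refine ⟨?_, h.2.2.1, h.2.2.2.2.1, h.2.2.2.2.2⟩
  exact Finset.sum_eq_zero fun k _ => h.1 k

theorem IsCubical.exists_raise_smash_eq {a b n : ℕ} {α : Fin a → ℕ} {β : Fin b → ℕ}
    {Γ : Fin (a+1) → Fin (b+1) → ℕ →₀ ℕ} (h : IsCubical α β n 1 Γ) :
    ∃ x : Fin a × Fin b, smash Γ x.1.succ x.2.succ ≠ 0 ∧ raise (smash Γ) x = Γ := by
  have hw := h.2.2.2.1
  rw [qWeight, ← Fintype.sum_prod_type'] at hw
  obtain ⟨⟨i, j⟩, hp, hq⟩ := exists_eq_one_of_sum_eq_one hw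
  have e := eq_single_add_single_of_weight_eq_one hp
  have hpos : Γ i j 1 = 1 := by rw [e]; simp
  have hi : i ≠ 0 := fun hi => by simp [h.2.1 i j 1 le_rfl (.inl hi)] at hpos
  have hj : j ≠ 0 := fun hj => by simp [h.2.1 i j 1 le_rfl (.inr hj)] at hpos
  obtain ⟨p, rfl⟩ := Fin.exists_succ_eq.mpr hi
  obtain ⟨q, rfl⟩ := Fin.exists_succ_eq.mpr hj
  refine ⟨(p, q), fun h0 => ?_, ?_⟩
  · have := Finset.sum_eq_zero_iff.mp h0 1 (by simp [hpos])
    simp [hpos] at this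
  · funext i j
    unfold raise
    split_ifs with hij
    · obtain ⟨rfl, rfl⟩ := hij
      exact e.symm
    · exact (eq_single_of_weight_eq_zero (hq (i, j) (by simpa using hij))).symm

theorem finite_setOf_isL {a b : ℕ} (α : Fin a → ℕ) (β : Fin b → ℕ) (n : ℕ) :
    {γ | IsL α β n γ}.Finite := by
  refine (Set.finite_Icc 0 (fun _ _ => n)).subset fun γ hγ => ⟨fun _ _ => Nat.zero_le _, ?_⟩
  intro i j
  calc γ i j ≤ ∑ j, γ i j := Finset.single_le_sum (by simp) (Finset.mem_univ j)
    _ ≤ ∑ i, ∑ j, γ i j :=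
      Finset.single_le_sum (f := fun i => ∑ j, γ i j) (by simp) (Finset.mem_univ i)
    _ ≤ n := hγ.2.1

/-- `|Q(α,β,n,1)| = Σ_{γ ∈ L(α,β,n)} f_γ`. -/
theorem stmt9 {a b : ℕ} (ha : 1 ≤ a) (hb : 1 ≤ b)
    (α : Fin a → ℕ) (β : Fin b → ℕ) (n : ℕ) :
    Set.ncard {Γ : Fin (a+1) → Fin (b+1) → ℕ →₀ ℕ | IsCubical α β n 1 Γ} =
      ∑ᶠ (γ : Fin (a+1) → Fin (b+1) → ℕ) (_ : IsL α β n γ),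
        (Finset.univ.filter (fun x : Fin a × Fin b => γ x.1.succ x.2.succ ≠ 0)).card := by
  have hfin := finite_setOf_isL α β n
  refine Eq.trans ?_ (finsum_mem_eq_finite_toFinset_sum _ hfin).symm
  rw [← Finset.card_sigma, ← Set.ncard_coe_finset]
  symm
  refine Set.ncard_congr (fun s _ => raise s.1 s.2) ?_ ?_ ?_
  · rintro ⟨γ, x⟩ h
    simp only [Finset.coe_sigma, Set.mem_sigma_iff, Finset.mem_coe, Set.Finite.mem_toFinset,
      Set.mem_ofPred_eq, Finset.mem_filter, Finset.mem_univ, true_and] at h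
    exact h.1.isCubical_raise h.2
  · rintro ⟨γ, x⟩ ⟨δ, y⟩ h h' e
    simp only [Finset.coe_sigma, Set.mem_sigma_iff, Finset.mem_coe, Set.Finite.mem_toFinset,
      Set.mem_ofPred_eq, Finset.mem_filter, Finset.mem_univ, true_and] at h h'
    obtain rfl : γ = δ := by
      rw [← smash_raise h.2, ← smash_raise h'.2]
      exact congrArg smash e
    exact congrArg _ (raise_injective_right γ e)
  · intro Γ hΓ
    obtain ⟨x, hx, e⟩ := IsCubical.exists_raise_smash_eq hΓ
    exact ⟨⟨smash Γ, x⟩, by simpa using ⟨IsCubical.isL_smash hΓ, hx⟩, e⟩
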